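/- Associativity of the ⊙ discounting: fix c > 0 and θ > 0 and define x ⊙ y = (p(x)/θ)·y. Then for all x, y, z ∈ Ω', it holds that x ⊙ (y ⊙ z) = (x ⊙ y) ⊙ z. -/

import Mathlib

noncomputable section

/-- The opinion space excluding dogmatic opinions. -/
def Omega' : Set (ℝ × ℝ × ℝ) :=
  {x | x.1 ∈ Set.Ico (0:ℝ) 1 ∧ x.2.1 ∈ Set.Ico (0:ℝ) 1 ∧ x.2.2 ∈ Set.Ioc (0:ℝ) 1 ∧
    x.1 + x.2.1 + x.2.2 = 1}

/-- The full uncertainty opinion U = (0,0,1). -/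
def Uop : ℝ × ℝ × ℝ := (0, 0, 1)

/-- The consensus operation ⊕. -/
def consensus (x y : ℝ × ℝ × ℝ) : ℝ × ℝ × ℝ :=
  ((x.2.2 * y.1 + y.2.2 * x.1) / (x.2.2 + y.2.2 - x.2.2 * y.2.2),
   (x.2.2 * y.2.1 + y.2.2 * x.2.1) / (x.2.2 + y.2.2 - x.2.2 * y.2.2),
   x.2.2 * y.2.2 / (x.2.2 + y.2.2 - x.2.2 * y.2.2))

/-- Scalar multiplication α·x of evidence. -/
def smulOp (α : ℝ) (x : ℝ × ℝ × ℝ) : ℝ × ℝ × ℝ :=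
  (α * x.1 / (α * (x.1 + x.2.1) + x.2.2),
   α * x.2.1 / (α * (x.1 + x.2.1) + x.2.2),
   x.2.2 / (α * (x.1 + x.2.1) + x.2.2))

/-- Positive evidence p(x) = c·x_b/x_u. -/
def pEv (c : ℝ) (x : ℝ × ℝ × ℝ) : ℝ := c * x.1 / x.2.2

/-- Negative evidence n(x) = c·x_d/x_u. -/
def nEv (c : ℝ) (x : ℝ × ℝ × ℝ) : ℝ := c * x.2.1 / x.2.2

/-- The new discounting rule x ⊠ y = g(x)·y. -/
def box (g : ℝ × ℝ × ℝ → ℝ) (x y : ℝ × ℝ × ℝ) : ℝ × ℝ × ℝ := smulOp (g x) y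

/-- Subjective Logic discounting x ⊗ y. -/
def otimesSL (x y : ℝ × ℝ × ℝ) : ℝ × ℝ × ℝ :=
  (x.1 * y.1, x.1 * y.2.1, x.2.1 + x.2.2 + x.1 * y.2.2)

/-- The specific discounting rule x ⊙ y = (p(x)/θ)·y. -/
def odot (c θ : ℝ) (x y : ℝ × ℝ × ℝ) : ℝ × ℝ × ℝ := smulOp (pEv c x / θ) y

theorem smulOp_smulOp (α : ℝ) {β : ℝ} {x : ℝ × ℝ × ℝ} (h : β * (x.1 + x.2.1) + x.2.2 ≠ 0) :
    smulOp α (smulOp β x) = smulOp (α * β) x := by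
  have key : α * (β * x.1 / (β * (x.1 + x.2.1) + x.2.2) +
      β * x.2.1 / (β * (x.1 + x.2.1) + x.2.2)) + x.2.2 / (β * (x.1 + x.2.1) + x.2.2) =
      (α * β * (x.1 + x.2.1) + x.2.2) / (β * (x.1 + x.2.1) + x.2.2) := by ring
  simp only [smulOp, key, mul_div_assoc', div_div_div_cancel_right₀ h, mul_assoc]

theorem pEv_smulOp (c : ℝ) {α : ℝ} {x : ℝ × ℝ × ℝ} (h : α * (x.1 + x.2.1) + x.2.2 ≠ 0) :
    pEv c (smulOp α x) = α * pEv c x := by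
  simp only [pEv, smulOp, mul_div_assoc', div_div_div_cancel_right₀ h, mul_left_comm]

theorem smulOp_denom_pos {α : ℝ} (hα : 0 ≤ α) {x : ℝ × ℝ × ℝ} (hx : x ∈ Omega') :
    0 < α * (x.1 + x.2.1) + x.2.2 := by
  obtain ⟨⟨hb, -⟩, ⟨hd, -⟩, ⟨hu, -⟩, -⟩ := hx
  positivity

theorem pEv_nonneg {c : ℝ} (hc : 0 ≤ c) {x : ℝ × ℝ × ℝ} (hx : x ∈ Omega') : 0 ≤ pEv c x := by
  obtain ⟨⟨hb, -⟩, -, ⟨hu, -⟩, -⟩ := hx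
  unfold pEv
  positivity

theorem stmt16 (c θ : ℝ) (hc : 0 < c) (hθ : 0 < θ)
    (x y z : ℝ × ℝ × ℝ) (hx : x ∈ Omega') (hy : y ∈ Omega') (hz : z ∈ Omega') :
    odot c θ x (odot c θ y z) = odot c θ (odot c θ x y) z := by
  have hpos {w : ℝ × ℝ × ℝ} (hw : w ∈ Omega') : 0 ≤ pEv c w / θ :=
    div_nonneg (pEv_nonneg hc.le hw) hθ.le
  unfold odot
  rw [smulOp_smulOp _ (smulOp_denom_pos (hpos hy) hz).ne',
    pEv_smulOp c (smulOp_denom_pos (hpos hx) hy).ne', mul_div_assoc]
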